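/- Assume conditions (C_g)(a) and (C_{f_n})(a)(b) with c > 0 and d ∈ (c, d*), fix κ⁺ ∈ (0, 1−ξ₁), and for all sufficiently large n let y^{+,n} : ℝ → ℝ be the unique solution of (E_{f_n}) on ℝ that is strictly increasing on (−∞,0] with y^{+,n}(0) = κ⁺ + ξ_{1,n}, lim_{t→−∞} y^{+,n}(t) = ξ_{1,n}, and y^{+,n}(ℝ) ⊂ (0, 2d/c). Then, for all sufficiently large n, y^{+,n}(t) → 0 as t → ∞. -/

import Mathlib

open Real Set Filter Topology MeasureTheory

noncomputable section

/-- Condition `(C_g)(a)`: `g` maps `[0,∞)` into `[0,1]`, the restriction of `g` to `[0,1]`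
is `C¹` with derivative `g'` (one-sided at the endpoints), `g = 0` on `(1,∞)`,
`g 0 = g' 0 = 0`, `g 1 = 1`, and `g' ξ > g ξ / ξ` for all `ξ ∈ (0,1]`. -/
structure CgA (g g' : ℝ → ℝ) : Prop where
  maps_to : ∀ ξ : ℝ, 0 ≤ ξ → g ξ ∈ Icc (0:ℝ) 1
  hasDeriv : ∀ ξ ∈ Icc (0:ℝ) 1, HasDerivWithinAt g (g' ξ) (Icc (0:ℝ) 1) ξ
  derivCont : ContinuousOn g' (Icc (0:ℝ) 1)
  eq_zero : ∀ ξ : ℝ, 1 < ξ → g ξ = 0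
  g_zero : g 0 = 0
  g'_zero : g' 0 = 0
  g_one : g 1 = 1
  slope : ∀ ξ : ℝ, 0 < ξ → ξ ≤ 1 → g ξ / ξ < g' ξ

/-- `x` is a (nonnegative, continuous) solution on `ℝ` of the delay equation
`x'(t) = -a·x(t) + b·F(x(t-1))`, in integral form. -/
def IsSolR (a b : ℝ) (F x : ℝ → ℝ) : Prop :=
  Continuous x ∧ (∀ t : ℝ, 0 ≤ x t) ∧
    ∀ τ t : ℝ, τ < t →
      IntervalIntegrable (fun s => Real.exp (-a * (t - s)) * F (x (s - 1))) volume τ t ∧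
      x t = Real.exp (-a * (t - τ)) * x τ
          + b * ∫ s in τ..t, Real.exp (-a * (t - s)) * F (x (s - 1))

/-- `x` is a (nonnegative, continuous) solution on `[T₁ - 1, ∞)` of the delay equation
`x'(t) = -a·x(t) + b·F(x(t-1))`, in integral form (identity for `T₁ ≤ τ < t`). -/
def IsSolOn (a b : ℝ) (F : ℝ → ℝ) (T₁ : ℝ) (x : ℝ → ℝ) : Prop :=
  ContinuousOn x (Ici (T₁ - 1)) ∧ (∀ t : ℝ, T₁ - 1 ≤ t → 0 ≤ x t) ∧
    ∀ τ t : ℝ, T₁ ≤ τ → τ < t →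
      IntervalIntegrable (fun s => Real.exp (-a * (t - s)) * F (x (s - 1))) volume τ t ∧
      x t = Real.exp (-a * (t - τ)) * x τ
          + b * ∫ s in τ..t, Real.exp (-a * (t - s)) * F (x (s - 1))

/-- `z` is the solution of `(E_g)` on `[0,∞)` with initial segment `z t = e^{-c t}` on `[0,1]`. -/
def IsZSol (c d : ℝ) (g z : ℝ → ℝ) : Prop :=
  IsSolOn c d g 1 z ∧ ∀ t ∈ Icc (0:ℝ) 1, z t = Real.exp (-c * t)

/-- Condition `(C_{f_n})(a)(b)`: `a n → c`, `b n → d`, each `f n : [0,∞) → [0,1)` is `C¹`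
with derivative `f' n`, `f n 0 = 0`, `f' n > 0` on `(0,1/2]`, the uniform closeness of
`(f n, f' n)` to `(g, g')` away from `1`, and the smallness of
`sup_{[1+κ,∞)}|f' n| · (sup_{[0,∞)}|f' n|)^m`. -/
structure Cfn (c d : ℝ) (g g' : ℝ → ℝ) (a b : ℕ → ℝ) (f f' : ℕ → ℝ → ℝ) : Prop where
  a_pos : ∀ n, 0 < a n
  b_pos : ∀ n, 0 < b n
  a_lim : Tendsto a atTop (nhds c)
  b_lim : Tendsto b atTop (nhds d)
  maps_to : ∀ n, ∀ ξ : ℝ, 0 ≤ ξ → f n ξ ∈ Ico (0:ℝ) 1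
  hasDeriv : ∀ n, ∀ ξ : ℝ, 0 ≤ ξ → HasDerivWithinAt (f n) (f' n ξ) (Ici (0:ℝ)) ξ
  derivCont : ∀ n, ContinuousOn (f' n) (Ici (0:ℝ))
  f_zero : ∀ n, f n 0 = 0
  f'_pos : ∀ n, ∀ ξ : ℝ, 0 < ξ → ξ ≤ 1/2 → 0 < f' n ξ
  close : ∀ κ : ℝ, 0 < κ → κ < 1 → ∀ ε : ℝ, 0 < ε → ∃ N : ℕ, ∀ n ≥ N,
      ∀ ξ : ℝ, (ξ ∈ Icc (0:ℝ) (1 - κ) ∨ 1 + κ ≤ ξ) →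
        |f n ξ - g ξ| + |f' n ξ - g' ξ| < ε
  small : ∀ κ : ℝ, 0 < κ → κ < 1 → ∀ m : ℕ, ∃ A B : ℕ → ℝ,
      (∀ n, ∀ ξ : ℝ, 1 + κ ≤ ξ → |f' n ξ| ≤ A n) ∧
      (∀ n, ∀ ξ : ℝ, 0 ≤ ξ → |f' n ξ| ≤ B n) ∧
      Tendsto (fun n => A n * (B n) ^ m) atTop (nhds 0)

/-- Condition `(H)`. -/
structure CondH (a b ξm ξp : ℝ) (h : ℝ → ℝ) : Prop where
  a_pos : 0 < a
  b_pos : 0 < b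
  ξm_neg : ξm < 0
  ξp_pos : 0 < ξp
  bdd : ∃ M : ℝ, ∀ ξ : ℝ, |h ξ| ≤ M
  smooth : ContDiff ℝ 1 h
  h_zero : h 0 = 0
  slope_zero : a < b * deriv h 0
  zero_m : -a * ξm + b * h ξm = 0
  zero_p : -a * ξp + b * h ξp = 0
  ratio : ∀ ξ : ℝ, ξm < ξ → ξ < ξp → ξ ≠ 0 → a / b < h ξ / ξ
  deriv_pos : ∀ ξ : ℝ, ξ ≠ ξm → ξ ≠ ξp → 0 < deriv h ξ

/-- Solution of `(E_h)`: `u'(t) = -a·u(t) + b·h(u(t-1))` on all of `ℝ`. -/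
def IsSolH (a b : ℝ) (h u : ℝ → ℝ) : Prop :=
  ∀ t : ℝ, HasDerivAt u (-a * u t + b * h (u (t - 1))) t

/-- Solution of `(E_h)` on `[-1,∞)`: continuous there, differentiable on `(0,∞)`
and satisfying the equation for `t > 0`. -/
def IsSolHOn (a b : ℝ) (h u : ℝ → ℝ) : Prop :=
  ContinuousOn u (Ici (-1:ℝ)) ∧
    ∀ t : ℝ, 0 < t → HasDerivAt u (-a * u t + b * h (u (t - 1))) t

/-- Solution of `(E_h)` on `(-∞,0]`. -/
def IsSolHIic (a b : ℝ) (h u : ℝ → ℝ) : Prop :=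
  ContinuousOn u (Iic (0:ℝ)) ∧
    ∀ t : ℝ, t ≤ 0 → HasDerivWithinAt u (-a * u t + b * h (u (t - 1))) (Iic (0:ℝ)) t

lemma aux_shift {a b : ℝ} {F y : ℝ → ℝ} (h : IsSolR a b F y) (T : ℝ) :
    IsSolR a b F (fun s => y (T + s)) := by
  obtain ⟨h1, h2, h3⟩ := h
  refine ⟨h1.comp (by fun_prop), fun t => h2 _, ?_⟩
  intro τ t ht
  obtain ⟨hi, he⟩ := h3 (T + τ) (T + t) (by linarith)
  have key : ∀ s : ℝ, Real.exp (-a * (T + t - (T + s))) * F (y (T + s - 1))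
      = Real.exp (-a * (t - s)) * F (y (T + (s - 1))) := by
    intro s
    rw [show T + t - (T + s) = t - s by ring, show T + s - 1 = T + (s - 1) by ring]
  constructor
  · have := hi.comp_add_left T
    simp only [add_sub_cancel_left] at this
    refine this.congr ?_
    intro s _
    exact key s
  · have e2 := intervalIntegral.integral_comp_add_left (a := τ) (b := t)
      (fun s => Real.exp (-a * (T + t - s)) * F (y (s - 1))) T
    simp only [key] at e2
    show y (T + t) = _
    rw [he, ← e2, show T + t - (T + τ) = t - τ by ring]

lemma aux_int (a τ t : ℝ) (ha : 0 < a) (m : ℝ) :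
    ∫ s in τ..t, Real.exp (-a * (t - s)) * m = (1 - Real.exp (-a * (t - τ))) / a * m := by
  rw [intervalIntegral.integral_mul_const]
  congr 1
  have : ∀ s ∈ uIcc τ t, HasDerivAt (fun s => Real.exp (-a * (t - s)) / a)
      (Real.exp (-a * (t - s))) s := by
    intro s _
    have h1 : HasDerivAt (fun s : ℝ => -a * (t - s)) a s := by
      have := ((hasDerivAt_id s).const_sub t).const_mul (-a)
      simpa using this
    have h2 := (h1.exp).div_const a
    rwa [mul_div_cancel_right₀ _ ha.ne'] at h2
  rw [intervalIntegral.integral_eq_sub_of_hasDerivAt this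
    (Continuous.intervalIntegrable (by fun_prop) _ _)]
  simp
  ring

lemma aux_lower {a b : ℝ} {F y : ℝ → ℝ} (h : IsSolR a b F y) (ha : 0 < a) (hb : 0 < b)
    {τ t m : ℝ} (ht : τ ≤ t) (hm : ∀ s ∈ Icc τ t, m ≤ F (y (s - 1))) :
    Real.exp (-a * (t - τ)) * y τ + b * ((1 - Real.exp (-a * (t - τ))) / a * m) ≤ y t := by
  rcases ht.eq_or_lt with rfl | ht'
  · simp
  obtain ⟨hi, he⟩ := h.2.2 τ t ht'
  rw [he, ← aux_int a τ t ha m]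
  gcongr
  refine intervalIntegral.integral_mono_on ht
    (Continuous.intervalIntegrable (by fun_prop) _ _) hi ?_
  intro s hs
  exact mul_le_mul_of_nonneg_left (hm s hs) (Real.exp_pos _).le

lemma aux_upper {a b : ℝ} {F y : ℝ → ℝ} (h : IsSolR a b F y) (ha : 0 < a) (hb : 0 < b)
    {τ t m : ℝ} (ht : τ ≤ t) (hm : ∀ s ∈ Icc τ t, F (y (s - 1)) ≤ m) :
    y t ≤ Real.exp (-a * (t - τ)) * y τ + b * ((1 - Real.exp (-a * (t - τ))) / a * m) := by
  rcases ht.eq_or_lt with rfl | ht'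
  · simp
  obtain ⟨hi, he⟩ := h.2.2 τ t ht'
  rw [he, ← aux_int a τ t ha m]
  gcongr
  refine intervalIntegral.integral_mono_on ht hi
    (Continuous.intervalIntegrable (by fun_prop) _ _) ?_
  intro s hs
  exact mul_le_mul_of_nonneg_left (hm s hs) (Real.exp_pos _).le

/-- the stability lemma -/
lemma aux_stab {a b : ℝ} {F y : ℝ → ℝ} (h : IsSolR a b F y) (ha : 0 < a) (hb : 0 < b)
    {S m : ℝ} (hm : 0 < m) (hS : ∀ t ∈ Icc S (S + 1), y t ≤ m)
    (hF : ∀ x ∈ Icc 0 m, b * F x ≤ a / 2 * x) : Tendsto y atTop (nhds 0) := by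
  have hy := h.2.1
  have gen : ∀ m' τ t : ℝ, m' ≤ m → τ ≤ t → (∀ s ∈ Icc τ t, y (s - 1) ≤ m') → y τ ≤ m' →
      y t ≤ Real.exp (-a * (t - τ)) * m' + (1 - Real.exp (-a * (t - τ))) * (m' / 2) := by
    intro m' τ t hm' ht hs h0
    have h1 := aux_upper h ha hb ht (m := a / (2 * b) * m') (by
      intro s hs'
      have h2 := hF (y (s - 1)) ⟨hy _, (hs s hs').trans hm'⟩
      have h3 := hs s hs'
      rw [show a / (2 * b) * m' = (a / 2 * m') / b by field_simp, le_div_iff₀ hb]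
      nlinarith)
    have h4 : b * ((1 - Real.exp (-a * (t - τ))) / a * (a / (2 * b) * m'))
      = (1 - Real.exp (-a * (t - τ))) * (m' / 2) := by field_simp
    rw [h4] at h1
    have := mul_le_mul_of_nonneg_left h0 (Real.exp_pos (-a * (t - τ))).le
    linarith
  have step1 : ∀ k : ℕ, ∀ t ∈ Icc S (S + 1 + k), y t ≤ m := by
    intro k
    induction k with
    | zero => simpa using hS
    | succ k ih =>
      intro t ht
      push_cast at ht
      by_cases hk : t ≤ S + 1 + k
      · exact ih t ⟨ht.1, hk⟩
      push Not at hk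
      have hk0 : (0:ℝ) ≤ k := k.cast_nonneg
      have := gen m (S + 1 + k) t le_rfl hk.le (by
        intro s hs
        exact ih _ ⟨by linarith [hs.1], by linarith [hs.2, ht.2]⟩)
        (ih _ ⟨by linarith, le_rfl⟩)
      have he := Real.exp_le_one_iff.2 (show -a * (t - (S + 1 + k)) ≤ 0 by nlinarith)
      nlinarith
  have step2 : ∀ t, S ≤ t → y t ≤ m := by
    intro t ht
    obtain ⟨k, hk⟩ := exists_nat_ge (t - S - 1)
    exact step1 k t ⟨ht, by linarith⟩
  have step3 : ∀ k : ℕ, ∃ R : ℝ, ∀ t, R ≤ t → y t ≤ (3/4) ^ k * m := by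
    intro k
    induction k with
    | zero => exact ⟨S, by simpa using step2⟩
    | succ k ih =>
      obtain ⟨R, hR⟩ := ih
      refine ⟨R + 1 + 1 / a * 2, ?_⟩
      intro t ht
      have h1a : 0 < 1 / a := by positivity
      have hp : (3/4 : ℝ) ^ k ≤ 1 := pow_le_one₀ (by norm_num) (by norm_num)
      have hp0 : (0 : ℝ) < (3/4 : ℝ) ^ k := by positivity
      have := gen ((3/4) ^ k * m) (R + 1) t (by nlinarith) (by linarith)
        (fun s hs => hR _ (by linarith [hs.1])) (hR _ (by linarith))
      have he : Real.exp (-a * (t - (R + 1))) ≤ 1 / 2 := by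
        have h5 : a * (1 / a * 2) ≤ a * (t - (R + 1)) :=
          mul_le_mul_of_nonneg_left (by linarith) ha.le
        have h6 : a * (1 / a * 2) = 2 := by field_simp
        have h7 : Real.exp (-a * (t - (R + 1))) ≤ Real.exp (-2) :=
          Real.exp_le_exp.2 (by linarith)
        have h8 : (2:ℝ) ≤ Real.exp 2 := by linarith [Real.add_one_le_exp (2:ℝ)]
        rw [Real.exp_neg] at h7
        refine h7.trans ?_
        rw [one_div]
        exact inv_anti₀ (by norm_num) h8
      rw [pow_succ]
      have : 0 < (3/4 : ℝ) ^ k * m := by positivity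
      nlinarith
  rw [Metric.tendsto_atTop]
  intro ε hε
  have hl : Tendsto (fun k : ℕ => (3/4 : ℝ) ^ k * m) atTop (nhds (0 * m)) :=
    (tendsto_pow_atTop_nhds_zero_of_lt_one (by norm_num) (by norm_num)).mul_const m
  rw [zero_mul] at hl
  obtain ⟨k, hk⟩ := (hl.eventually (gt_mem_nhds hε)).exists
  obtain ⟨R, hR⟩ := step3 k
  refine ⟨R, fun t ht => ?_⟩
  rw [Real.dist_eq, sub_zero, abs_of_nonneg (hy t)]
  exact (hR t ht).trans_lt hk

/-- up to first hitting of level `q` -/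
lemma aux_mono {a b : ℝ} {F y : ℝ → ℝ} (h : IsSolR a b F y) (ha : 0 < a) (hb : 0 < b)
    {q M : ℝ} (hF0 : ∀ x, 0 ≤ x → 0 ≤ F x) (hmono : MonotoneOn F (Icc 0 q))
    (hM : ∀ t, y t ≤ M) {τ : ℝ} (hτ : MonotoneOn y (Iic τ)) (hq : y τ ≤ q) :
    (∀ t ≤ τ + 1, 0 ≤ -a * y t + b * F (y (t - 1))) ∧ MonotoneOn y (Iic (τ + 1)) := by
  have hy := h.2.1
  have hFm : ∀ s t, s ≤ t → t ≤ τ + 1 → F (y (s - 1)) ≤ F (y (t - 1)) := by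
    intro s t hst ht
    have h1 : y (s - 1) ≤ y (t - 1) :=
      hτ (show s - 1 ≤ τ by linarith) (show t - 1 ≤ τ by linarith) (by linarith)
    have h2 : y (t - 1) ≤ y τ :=
      hτ (show t - 1 ≤ τ by linarith) (show τ ≤ τ from le_rfl) (by linarith)
    exact hmono ⟨hy _, by linarith⟩ ⟨hy _, by linarith⟩ h1
  have hv : ∀ t ≤ τ + 1, 0 ≤ -a * y t + b * F (y (t - 1)) := by
    intro t ht
    have h1 : ∀ r ≤ t, Real.exp (-a * (t - r)) * (-a * M) ≤ -a * y t + b * F (y (t - 1)) := by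
      intro r hr
      have := aux_upper h ha hb hr (m := F (y (t - 1))) (fun s hs => hFm s t hs.2 ht)
      have h2 := mul_le_mul_of_nonneg_left this ha.le
      have h3 : a * (Real.exp (-a * (t - r)) * y r +
          b * ((1 - Real.exp (-a * (t - r))) / a * F (y (t - 1))))
          = Real.exp (-a * (t - r)) * (a * y r) +
          b * ((1 - Real.exp (-a * (t - r))) * F (y (t - 1))) := by field_simp
      rw [h3] at h2
      have he := Real.exp_pos (-a * (t - r))
      have h4 := mul_le_mul_of_nonneg_left (mul_le_mul_of_nonneg_left (hM r) ha.le) he.le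
      have h5 : 0 ≤ Real.exp (-a * (t - r)) * (b * F (y (t - 1))) := by
        have := hF0 _ (hy (t - 1)); positivity
      nlinarith
    have hl : Tendsto (fun r : ℝ => Real.exp (-a * (t - r)) * (-a * M)) atBot
        (nhds (0 * (-a * M))) := by
      refine Tendsto.mul_const _ (Real.tendsto_exp_atBot.comp ?_)
      have : Tendsto (fun r : ℝ => a * r + (-a * t)) atBot atBot :=
        tendsto_atBot_add_const_right _ _ (tendsto_id.const_mul_atBot ha)
      refine this.congr (fun r => by ring)
    rw [zero_mul] at hl
    exact le_of_tendsto hl ((eventually_le_atBot t).mono h1)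
  refine ⟨hv, ?_⟩
  intro s hs t ht hst
  have h1 := aux_lower h ha hb hst (m := F (y (s - 1))) (fun r hr => hFm s r hr.1 (hr.2.trans ht))
  have h2 := hv s hs
  have he := Real.exp_le_one_iff.2 (show -a * (t - s) ≤ 0 by nlinarith)
  have h3 : Real.exp (-a * (t - s)) * y s + b * ((1 - Real.exp (-a * (t - s))) / a * F (y (s - 1)))
     = y s + (1 - Real.exp (-a * (t - s))) / a * (-a * y s + b * F (y (s - 1))) := by
    field_simp; ring
  have h4 : 0 ≤ (1 - Real.exp (-a * (t - s))) / a * (-a * y s + b * F (y (s - 1))) :=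
    mul_nonneg (div_nonneg (by linarith) ha.le) h2
  linarith

lemma aux_hit {a b : ℝ} {F y : ℝ → ℝ} (h : IsSolR a b F y) (ha : 0 < a) (hb : 0 < b)
    {q M : ℝ} (hF0 : ∀ x, 0 ≤ x → 0 ≤ F x) (hFc : ContinuousOn F (Ici 0))
    (hmono : MonotoneOn F (Icc 0 q))
    (hM : ∀ t, y t ≤ M) (hτ : MonotoneOn y (Iic 0)) (hq : y 0 ≤ q)
    (hpos : ∀ x ∈ Icc (y 0) q, a * x < b * F x) :
    ∃ T, y T = q ∧ MonotoneOn y (Iic (T + 1)) := by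
  have hy := h.2.1
  by_cases hall : ∀ k : ℕ, y k ≤ q
  · exfalso
    have hm : ∀ k : ℕ, MonotoneOn y (Iic (k:ℝ)) := by
      intro k
      induction k with
      | zero => simpa using hτ
      | succ k ih =>
        have := (aux_mono h ha hb hF0 hmono hM ih (hall k)).2
        simpa using this
    have hmon : Monotone y := by
      intro s t hst
      obtain ⟨k, hk⟩ := exists_nat_ge t
      exact hm k (show s ≤ k by linarith) hk hst
    have hbd : ∀ t, y t ≤ q := by
      intro t
      obtain ⟨k, hk⟩ := exists_nat_ge t
      exact (hmon hk).trans (hall k)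
    have hlim := tendsto_atTop_ciSup hmon ⟨q, by rintro _ ⟨t, rfl⟩; exact hbd t⟩
    set L := ⨆ i, y i with hL
    have hLq : L ≤ q := le_of_tendsto' hlim hbd
    have hL0 : y 0 ≤ L := ge_of_tendsto hlim ((eventually_ge_atTop 0).mono (fun t ht => hmon ht))
    have hLn : 0 ≤ L := (hy 0).trans hL0
    have hFL : Tendsto (fun t => F (y (t - 1))) atTop (nhds (F L)) := by
      have h1 := hFc L hLn
      refine h1.tendsto.comp (tendsto_nhdsWithin_iff.2 ⟨?_, ?_⟩)
      · exact hlim.comp (tendsto_atTop_add_const_right _ (-1) tendsto_id)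
      · exact Eventually.of_forall (fun t => hy _)
    have hin : ∀ t, Real.exp (-a * 1) * y t + b * ((1 - Real.exp (-a * 1)) / a * F (y (t - 1)))
        ≤ y (t + 1) := by
      intro t
      have := aux_lower h ha hb (show t ≤ t + 1 by linarith) (m := F (y (t - 1))) (by
        intro s hs
        exact hmono ⟨hy _, hbd _⟩ ⟨hy _, hbd _⟩ (hmon (by linarith [hs.1])))
      simpa using this
    have hl1 : Tendsto (fun t => Real.exp (-a * 1) * y t +
        b * ((1 - Real.exp (-a * 1)) / a * F (y (t - 1)))) atTop
        (nhds (Real.exp (-a * 1) * L + b * ((1 - Real.exp (-a * 1)) / a * F L))) :=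
      (hlim.const_mul _).add ((hFL.const_mul _).const_mul _)
    have hl2 : Tendsto (fun t => y (t + 1)) atTop (nhds L) :=
      hlim.comp (tendsto_atTop_add_const_right _ 1 tendsto_id)
    have h1 := le_of_tendsto_of_tendsto' hl1 hl2 hin
    have h2 := hpos L ⟨hL0, hLq⟩
    have he : Real.exp (-a * 1) < 1 := Real.exp_lt_one_iff.2 (by linarith)
    have h3 : Real.exp (-a * 1) * L + b * ((1 - Real.exp (-a * 1)) / a * F L)
      = L + (1 - Real.exp (-a * 1)) / a * (b * F L - a * L) := by field_simp; ring
    have h4 : 0 < (1 - Real.exp (-a * 1)) / a * (b * F L - a * L) :=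
      mul_pos (div_pos (by linarith) ha) (by linarith)
    linarith
  · push Not at hall
    classical
    set k := Nat.find hall with hk
    have hk1 : q < y k := Nat.find_spec hall
    have hk2 : ∀ j < k, y j ≤ q := fun j hj => not_lt.1 (Nat.find_min hall hj)
    have hk0 : k ≠ 0 := by
      intro h0
      rw [h0] at hk1
      simp at hk1
      linarith
    have hm : ∀ j : ℕ, j ≤ k → MonotoneOn y (Iic (j:ℝ)) := by
      intro j
      induction j with
      | zero => intro _; simpa using hτ
      | succ j ih =>
        intro hj
        have := (aux_mono h ha hb hF0 hmono hM (ih (by omega)) (hk2 j (by omega))).2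
        simpa using this
    obtain ⟨j, hj⟩ := Nat.exists_eq_succ_of_ne_zero hk0
    have hjk : (j:ℝ) ≤ k := by rw [hj]; push_cast; linarith
    obtain ⟨T, hT, hTq⟩ := intermediate_value_Icc hjk h.1.continuousOn
      ⟨hk2 j (by omega), hk1.le⟩
    refine ⟨T, hTq, ?_⟩
    exact (aux_mono h ha hb hF0 hmono hM ((hm k le_rfl).mono (Iic_subset_Iic.2 hT.2)) hTq.le).2

lemma aux_rise {a b : ℝ} {F y : ℝ → ℝ} (h : IsSolR a b F y) (ha : 0 < a) (hb : 0 < b)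
    {q C v T : ℝ} (hv : 0 < v) (hmono : MonotoneOn F (Icc 0 q))
    (hC : (Real.exp a - 1) / a ≤ C)
    (hlow : ∀ x ∈ Icc (q - C * v) q, v ≤ -a * q + b * F x)
    (hT : y T = q) (hm : MonotoneOn y (Iic (T + 1))) :
    ∀ t ∈ Icc T (T + 1), q + v * ((1 - Real.exp (-a * (t - T))) / a) ≤ y t := by
  have hy := h.2.1
  have hle : ∀ s ≤ T, y s ≤ q := by
    intro s hs
    rw [← hT]
    exact hm (show s ≤ T + 1 by linarith) (show T ≤ T + 1 by linarith) hs
  have hFm : ∀ s t, s ≤ t → t ≤ T + 1 → F (y (s - 1)) ≤ F (y (t - 1)) := by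
    intro s t hst ht
    exact hmono ⟨hy _, hle _ (by linarith)⟩ ⟨hy _, hle _ (by linarith)⟩
      (hm (show s - 1 ≤ T + 1 by linarith) (show t - 1 ≤ T + 1 by linarith) (by linarith))
  have hvT : v ≤ -a * q + b * F (y (T - 1)) := by
    by_contra hcon
    push Not at hcon
    set e := -a * q + b * F (y (T - 1)) with he
    have h1 := aux_upper h ha hb (show T - 1 ≤ T by linarith) (m := F (y (T - 1)))
      (fun s hs => hFm s T hs.2 (by linarith))
    rw [hT, show -a * (T - (T - 1)) = -a by ring] at h1
    have hE : Real.exp (-a) * Real.exp a = 1 := by rw [← Real.exp_add]; simp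
    have hEp := Real.exp_pos a
    have hEm := Real.exp_pos (-a)
    have hE1 : 1 < Real.exp a := Real.one_lt_exp_iff.2 ha
    have h2 : Real.exp (-a) * y (T - 1) + b * ((1 - Real.exp (-a)) / a * F (y (T - 1)))
        = Real.exp (-a) * y (T - 1) + (1 - Real.exp (-a)) * (q + e / a) := by
      rw [he]; field_simp; ring
    rw [h2] at h1
    have h3 : q - (Real.exp a - 1) / a * e ≤ y (T - 1) := by
      have h4 := mul_le_mul_of_nonneg_left h1 hEp.le
      have h5 : Real.exp a * (Real.exp (-a) * y (T - 1) + (1 - Real.exp (-a)) * (q + e / a))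
        = (Real.exp (-a) * Real.exp a) * y (T - 1) +
          (Real.exp a - Real.exp (-a) * Real.exp a) * (q + e / a) := by ring
      rw [h5, hE] at h4
      have : (Real.exp a - 1) / a * e = (Real.exp a - 1) * (e / a) := by ring
      rw [this]
      linarith
    have hD : 0 < (Real.exp a - 1) / a := div_pos (by linarith) ha
    have h6 : (Real.exp a - 1) / a * e ≤ C * v := by
      calc (Real.exp a - 1) / a * e ≤ (Real.exp a - 1) / a * v :=
            mul_le_mul_of_nonneg_left hcon.le hD.le
        _ ≤ C * v := mul_le_mul_of_nonneg_right hC hv.le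
    have := hlow (y (T - 1)) ⟨by linarith, hle _ (by linarith)⟩
    linarith
  intro t ht
  have h1 := aux_lower h ha hb ht.1 (m := F (y (T - 1))) (fun r hr => hFm T r hr.1 (hr.2.trans ht.2))
  rw [hT] at h1
  have he := Real.exp_le_one_iff.2 (show -a * (t - T) ≤ 0 by nlinarith [ht.1])
  have h3 : Real.exp (-a * (t - T)) * q + b * ((1 - Real.exp (-a * (t - T))) / a * F (y (T - 1)))
     = q + (-a * q + b * F (y (T - 1))) * ((1 - Real.exp (-a * (t - T))) / a) := by
    field_simp; ring
  have h4 : v * ((1 - Real.exp (-a * (t - T))) / a) ≤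
      (-a * q + b * F (y (T - 1))) * ((1 - Real.exp (-a * (t - T))) / a) :=
    mul_le_mul_of_nonneg_right hvT (div_nonneg (by linarith) ha.le)
  linarith

lemma aux_plateau {a b : ℝ} {F y : ℝ → ℝ} (h : IsSolR a b F y) (ha : 0 < a) (hb : 0 < b)
    {q v T θ δ ε : ℝ} (hF0 : ∀ x, 0 ≤ x → 0 ≤ F x) (hv : 0 < v) (hθ : 0 < θ) (hθ1 : θ < 1)
    (hδ : 0 < δ)
    (hrise : ∀ t ∈ Icc T (T + 1), q + v * ((1 - Real.exp (-a * (t - T))) / a) ≤ y t)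
    (h1 : 1 + δ ≤ q + v * ((1 - Real.exp (-a * θ)) / a))
    (h2 : 1 + δ ≤ Real.exp (-a * θ) * (q + v * ((1 - Real.exp (-a)) / a)))
    (hε : ∀ x, 1 + δ ≤ x → F x ≤ ε) (hε2 : b * ε / a < 1 + δ) :
    ∃ T2, y T2 = 1 + δ ∧ ∀ s ∈ Icc (T2 - 1) T2, 1 + δ ≤ y s := by
  have hy := h.2.1
  have hε0 : 0 ≤ ε := (hF0 (1 + δ) (by linarith)).trans (hε _ le_rfl)
  have hpl : ∀ t ∈ Icc (T + θ) (T + θ + 1), 1 + δ ≤ y t := by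
    intro t ht
    by_cases htT : t ≤ T + 1
    · refine h1.trans (le_trans ?_ (hrise t ⟨by linarith [ht.1], htT⟩))
      have : Real.exp (-a * (t - T)) ≤ Real.exp (-a * θ) :=
        Real.exp_le_exp.2 (by nlinarith [ht.1])
      gcongr
    · push Not at htT
      have h3 := aux_lower h ha hb htT.le (m := 0) (fun s _ => hF0 _ (hy _))
      have h4 := hrise (T + 1) ⟨by linarith, le_rfl⟩
      rw [show -a * (T + 1 - T) = -a by ring] at h4
      have h5 : Real.exp (-a * θ) ≤ Real.exp (-a * (t - (T + 1))) :=
        Real.exp_le_exp.2 (by nlinarith [ht.2])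
      have h6 : Real.exp (-a * θ) * (q + v * ((1 - Real.exp (-a)) / a)) ≤
          Real.exp (-a * θ) * y (T + 1) := mul_le_mul_of_nonneg_left h4 (Real.exp_pos _).le
      have h7 : Real.exp (-a * θ) * y (T + 1) ≤ Real.exp (-a * (t - (T + 1))) * y (T + 1) :=
        mul_le_mul_of_nonneg_right h5 (hy _)
      simp only [mul_zero, add_zero] at h3
      linarith
  set T0 := T + θ + 1 with hT0
  -- exists a time with y < 1 + δ
  have hex : ∃ t, T0 ≤ t ∧ y t ≤ 1 + δ := by
    by_contra hcon
    push Not at hcon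
    have hup : ∀ t, T0 ≤ t → 1 + δ ≤ Real.exp (-a * (t - T0)) * y T0 + b * ε / a := by
      intro t ht
      have h3 := aux_upper h ha hb ht (m := ε) (by
        intro s hs
        apply hε
        by_cases hs1 : s - 1 ≤ T0
        · exact hpl _ ⟨by linarith [hs.1], hs1⟩
        · exact (hcon _ (by linarith)).le)
      have h4 := Real.exp_pos (-a * (t - T0))
      have h5 : b * ((1 - Real.exp (-a * (t - T0))) / a * ε) =
        b * ε / a - Real.exp (-a * (t - T0)) * (b * ε / a) := by ring
      have h6 : 0 ≤ Real.exp (-a * (t - T0)) * (b * ε / a) := by positivity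
      have := hcon t ht
      linarith
    have hl : Tendsto (fun t : ℝ => Real.exp (-a * (t - T0)) * y T0 + b * ε / a) atTop
        (nhds (0 * y T0 + b * ε / a)) := by
      refine Tendsto.add_const _ (Tendsto.mul_const _ (Real.tendsto_exp_atBot.comp ?_))
      have : Tendsto (fun r : ℝ => -a * r + (a * T0)) atTop atBot :=
        tendsto_atBot_add_const_right _ _ (tendsto_id.const_mul_atTop_of_neg (by linarith))
      refine this.congr (fun r => by ring)
    have := ge_of_tendsto hl ((eventually_ge_atTop T0).mono hup)
    linarith
  set A := {t | T0 ≤ t ∧ y t ≤ 1 + δ} with hA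
  have hAc : IsClosed A := isClosed_Ici.inter (isClosed_le h.1 continuous_const)
  have hAb : BddBelow A := ⟨T0, fun t ht => ht.1⟩
  have hmem := hAc.csInf_mem hex hAb
  set T2 := sInf A with hT2
  have hbefore : ∀ t, T0 ≤ t → t < T2 → 1 + δ < y t := by
    intro t ht htT
    by_contra hcon
    exact absurd (csInf_le hAb (show t ∈ A from ⟨ht, not_lt.1 hcon⟩)) (not_le.2 htT)
  have hge : 1 + δ ≤ y T2 := by
    rcases hmem.1.eq_or_lt with he | hlt
    · rw [← he]; exact hpl _ ⟨by linarith, le_rfl⟩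
    · have h7 : Tendsto y (𝓝[<] T2) (nhds (y T2)) := h.1.continuousAt.continuousWithinAt
      refine ge_of_tendsto h7 ?_
      have : Ioo T0 T2 ∈ 𝓝[<] T2 := Ioo_mem_nhdsLT hlt
      filter_upwards [this] with t ht
      exact (hbefore t ht.1.le ht.2).le
  refine ⟨T2, le_antisymm hmem.2 hge, ?_⟩
  intro s hs
  have hm1 := hmem.1
  by_cases hs1 : s ≤ T0
  · exact hpl s ⟨by linarith [hs.1], hs1⟩
  · push Not at hs1
    rcases hs.2.eq_or_lt with he | hlt
    · rw [he]; exact hge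
    · exact (hbefore s hs1.le hlt).le

lemma aux_fconv {c d : ℝ} {g g' : ℝ → ℝ} (hg : CgA g g')
    {a b : ℕ → ℝ} {f f' : ℕ → ℝ → ℝ} (hf : Cfn c d g g' a b f f')
    {x : ℕ → ℝ} {ℓ : ℝ} (hx : Tendsto x atTop (nhds ℓ)) (hx0 : ∀ᶠ n in atTop, 0 ≤ x n)
    (hℓ : ℓ ≠ 1) : Tendsto (fun n => f n (x n)) atTop (nhds (g ℓ)) := by
  have hℓ0 : 0 ≤ ℓ := ge_of_tendsto hx hx0
  -- convergence of g (x n)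
  have hgx : Tendsto (fun n => g (x n)) atTop (nhds (g ℓ)) := by
    rcases lt_or_gt_of_ne hℓ with hl | hl
    · have h1 := (hg.hasDeriv ℓ ⟨hℓ0, hl.le⟩).continuousWithinAt
      refine h1.tendsto.comp (tendsto_nhdsWithin_iff.2 ⟨hx, ?_⟩)
      filter_upwards [hx0, hx.eventually (gt_mem_nhds hl)] with n h2 h3
      exact ⟨h2, h3.le⟩
    · rw [hg.eq_zero ℓ hl]
      refine tendsto_const_nhds.congr' ?_
      filter_upwards [hx.eventually (lt_mem_nhds hl)] with n h3
      rw [hg.eq_zero _ h3]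
  have hdiff : Tendsto (fun n => f n (x n) - g (x n)) atTop (nhds 0) := by
    rw [Metric.tendsto_atTop']
    intro ε hε
    have : ∃ κ : ℝ, 0 < κ ∧ κ < 1 ∧ ∀ᶠ n in atTop, x n ∈ Icc 0 (1 - κ) ∨ 1 + κ ≤ x n := by
      rcases lt_or_gt_of_ne hℓ with hl | hl
      · refine ⟨(1 - ℓ) / 2, by linarith, by linarith, ?_⟩
        filter_upwards [hx0, hx.eventually (gt_mem_nhds (show ℓ < (1 + ℓ) / 2 by linarith))]
          with n h2 h3
        exact Or.inl ⟨h2, by linarith⟩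
      · refine ⟨min ((ℓ - 1) / 2) (1/2), lt_min (by linarith) (by norm_num),
          (min_le_right _ _).trans_lt (by norm_num), ?_⟩
        filter_upwards [hx.eventually (lt_mem_nhds (show (1 + ℓ) / 2 < ℓ by linarith))] with n h3
        refine Or.inr ?_
        have := min_le_left ((ℓ - 1) / 2) (1/2)
        linarith
    obtain ⟨κ, hκ0, hκ1, hev⟩ := this
    obtain ⟨N, hN⟩ := hf.close κ hκ0 hκ1 ε hε
    obtain ⟨N', hN'⟩ := eventually_atTop.1 hev
    refine ⟨max N N', fun n hn => ?_⟩
    have h4 := hN n ((le_max_left _ _).trans hn.le) (x n) (hN' n ((le_max_right _ _).trans hn.le))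
    rw [Real.dist_eq, sub_zero]
    linarith [abs_nonneg (f' n (x n) - g' (x n))]
  simpa using hdiff.add hgx

lemma aux_dct {c d : ℝ} {g g' : ℝ → ℝ}
    {a b : ℕ → ℝ} {f f' : ℕ → ℝ → ℝ} (hf : Cfn c d g g' a b f f')
    {u : ℕ → ℝ → ℝ} (hu : ∀ᶠ n in atTop, IsSolR (a n) (b n) (f n) (u n))
    {τ t ℓ : ℝ} (hτ : τ < t) (hℓ : Tendsto (fun n => u n τ) atTop (nhds ℓ)) {G : ℝ → ℝ}
    (hG : ∀ s ∈ Ioo τ t, Tendsto (fun n => f n (u n (s - 1))) atTop (nhds (G s))) :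
    Tendsto (fun n => u n t) atTop
      (nhds (Real.exp (-c * (t - τ)) * ℓ + d * ∫ s in τ..t, Real.exp (-c * (t - s)) * G s)) := by
  have hexp : ∀ r : ℝ, Tendsto (fun n => Real.exp (-a n * r)) atTop (nhds (Real.exp (-c * r))) :=
    fun r => (Real.continuous_exp.tendsto _).comp ((hf.a_lim.neg).mul_const r)
  have hint : Tendsto (fun n => ∫ s in τ..t, Real.exp (-a n * (t - s)) * f n (u n (s - 1))) atTop
      (nhds (∫ s in τ..t, Real.exp (-c * (t - s)) * G s)) := by
    refine intervalIntegral.tendsto_integral_filter_of_dominated_convergence (fun _ => (1:ℝ))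
      ?_ ?_ (by simp) ?_
    · filter_upwards [hu] with n hn
      have := (hn.2.2 τ t hτ).1.1.aestronglyMeasurable
      rwa [uIoc_of_le hτ.le]
    · filter_upwards [hu] with n hn
      refine Eventually.of_forall (fun s hs => ?_)
      rw [uIoc_of_le hτ.le] at hs
      have h1 := hf.maps_to n _ (hn.2.1 (s - 1))
      have h2 : Real.exp (-a n * (t - s)) ≤ 1 :=
        Real.exp_le_one_iff.2 (by nlinarith [hf.a_pos n, hs.2])
      rw [Real.norm_eq_abs, abs_mul, abs_of_pos (Real.exp_pos _), abs_of_nonneg h1.1]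
      nlinarith [h1.1, h1.2, Real.exp_pos (-a n * (t - s))]
    · have : ∀ᵐ s : ℝ, s ≠ t := by
        simp [ae_iff, measure_singleton]
      filter_upwards [this] with s hst hs
      rw [uIoc_of_le hτ.le] at hs
      exact (hexp (t - s)).mul (hG s ⟨hs.1, lt_of_le_of_ne hs.2 hst⟩)
  have := ((hexp (t - τ)).mul hℓ).add (hf.b_lim.mul hint)
  refine this.congr' ?_
  filter_upwards [hu] with n hn
  exact ((hn.2.2 τ t hτ).2).symm

lemma aux_toz {c d : ℝ} {g g' : ℝ → ℝ} (hg : CgA g g') (hc : 0 < c)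
    {a b : ℕ → ℝ} {f f' : ℕ → ℝ → ℝ} (hf : Cfn c d g g' a b f f')
    {z : ℝ → ℝ} (hz : IsZSol c d g z) (hz1 : ∀ t, 0 < t → z t < 1)
    {u : ℕ → ℝ → ℝ} (hu : ∀ᶠ n in atTop, IsSolR (a n) (b n) (f n) (u n)) {δ : ℝ} (hδ : 0 < δ)
    (hδ1 : Real.log (1 + δ) / c < 1)
    (hu0 : ∀ᶠ n in atTop, u n 0 = 1 + δ ∧ ∀ s ∈ Icc (-1:ℝ) 0, 1 + δ ≤ u n s) :
    ∀ t, 0 ≤ t → Tendsto (fun n => u n (Real.log (1 + δ) / c + t)) atTop (nhds (z t)) := by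
  set ρ := Real.log (1 + δ) / c with hρ
  have hρ0 : 0 < ρ := div_pos (Real.log_pos (by linarith)) hc
  have hcρ : Real.exp (c * ρ) = 1 + δ := by
    rw [hρ, mul_div_cancel₀ _ hc.ne', Real.exp_log (by linarith)]
  have hnn : ∀ s, ∀ᶠ n in atTop, 0 ≤ u n s := fun s => hu.mono (fun n hn => hn.2.1 s)
  have hl0 : Tendsto (fun n => u n 0) atTop (nhds (1 + δ)) :=
    tendsto_const_nhds.congr' (hu0.mono (fun n hn => hn.1.symm))
  -- vanishing of the nonlinearity on the plateau
  have hpl : ∀ s ∈ Icc (-1:ℝ) 0, Tendsto (fun n => f n (u n s)) atTop (nhds 0) := by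
    intro s hs
    rw [Metric.tendsto_atTop']
    intro ε hε
    obtain ⟨N, hN⟩ := hf.close (min δ (1/2)) (lt_min hδ (by norm_num))
      ((min_le_right _ _).trans_lt (by norm_num)) ε hε
    obtain ⟨N', hN'⟩ := eventually_atTop.1 hu0
    refine ⟨max N N', fun n hn => ?_⟩
    have h1 := (hN' n ((le_max_right _ _).trans hn.le)).2 s hs
    have h4 := hN n ((le_max_left _ _).trans hn.le) (u n s)
      (Or.inr (by linarith [min_le_left δ (1/2)]))
    rw [hg.eq_zero _ (by linarith), sub_zero] at h4
    rw [Real.dist_eq, sub_zero]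
    linarith [abs_nonneg (f' n (u n s) - g' (u n s))]
  have c1 : ∀ t, 0 ≤ t → t ≤ 1 →
      Tendsto (fun n => u n t) atTop (nhds (Real.exp (-c * t) * (1 + δ))) := by
    intro t ht0 ht1
    rcases ht0.eq_or_lt with rfl | ht
    · simpa using hl0
    have := aux_dct hf hu ht hl0 (G := fun _ => 0)
      (fun s hs => hpl _ ⟨by linarith [hs.1], by linarith [hs.2]⟩)
    simpa using this
  have c2 : ∀ t, 0 ≤ t → t ≤ 1 + ρ →
      Tendsto (fun n => u n t) atTop (nhds (Real.exp (-c * t) * (1 + δ))) := by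
    intro t ht0 ht1
    rcases ht0.eq_or_lt with rfl | ht
    · simpa using hl0
    have := aux_dct hf hu ht hl0 (G := fun _ => 0) (by
      intro s hs
      by_cases hs1 : s ≤ 1
      · exact hpl _ ⟨by linarith [hs.1], by linarith⟩
      · push Not at hs1
        have h5 := c1 (s - 1) (by linarith) (by linarith [hs.2])
        have h6 : 1 < Real.exp (-c * (s - 1)) * (1 + δ) := by
          rw [← hcρ, ← Real.exp_add]
          apply Real.one_lt_exp_iff.2
          have : s - 1 < ρ := by linarith [hs.2]
          nlinarith
        have h7 := aux_fconv hg hf h5 (hnn _) h6.ne'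
        rwa [hg.eq_zero _ h6] at h7)
    simpa using this
  have hU : ∀ᶠ n in atTop, IsSolR (a n) (b n) (f n) (fun s => u n (ρ + s)) :=
    hu.mono (fun n hn => aux_shift hn ρ)
  have c3 : ∀ k : ℕ, ∀ t : ℝ, 0 ≤ t → t ≤ 1 + k →
      Tendsto (fun n => u n (ρ + t)) atTop (nhds (z t)) := by
    intro k
    induction k with
    | zero =>
      intro t ht0 ht1
      simp only [Nat.cast_zero, add_zero] at ht1
      have := c2 (ρ + t) (by linarith) (by linarith)
      rw [hz.2 t ⟨ht0, ht1⟩]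
      rwa [← hcρ, ← Real.exp_add, show -c * (ρ + t) + c * ρ = -c * t by ring] at this
    | succ k ih =>
      intro t ht0 ht1
      push_cast at ht1
      have hk0 : (0:ℝ) ≤ k := k.cast_nonneg
      by_cases ht : t ≤ 1 + k
      · exact ih t ht0 ht
      push Not at ht
      have h1t : 1 < t := by linarith
      have h5 := aux_dct hf hU h1t (ih 1 (by norm_num) (by linarith))
        (G := fun s => g (z (s - 1))) (by
          intro s hs
          have h6 := ih (s - 1) (by linarith [hs.1]) (by linarith [hs.2])
          exact aux_fconv hg hf h6 (hnn _) (hz1 _ (by linarith [hs.1])).ne)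
      rwa [← (hz.1.2.2 1 t le_rfl h1t).2] at h5
  intro t ht
  obtain ⟨k, hk⟩ := exists_nat_ge t
  exact c3 k t ht (by linarith)

lemma aux_U {c d : ℝ} {g g' : ℝ → ℝ}
    {a b : ℕ → ℝ} {f f' : ℕ → ℝ → ℝ} (hf : Cfn c d g g' a b f f')
    {q ε : ℝ} (hq0 : 0 < q) (hq : q < 1) (hε : 0 < ε) :
    ∀ᶠ n in atTop, ∀ x ∈ Icc 0 q, |f n x - g x| < ε ∧ |f' n x - g' x| < ε := by
  obtain ⟨N, hN⟩ := hf.close (1 - q) (by linarith) (by linarith) ε hε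
  filter_upwards [eventually_ge_atTop N] with n hn x hx
  have := hN n hn x (Or.inl ⟨hx.1, by linarith [hx.2]⟩)
  constructor
  · linarith [abs_nonneg (f' n x - g' x)]
  · linarith [abs_nonneg (f n x - g x)]

lemma aux_U2 {c d : ℝ} {g g' : ℝ → ℝ} (hd : 0 < d)
    {a b : ℕ → ℝ} {f f' : ℕ → ℝ → ℝ} (hf : Cfn c d g g' a b f f')
    {q ε : ℝ} (hq0 : 0 < q) (hq : q < 1) (hε : 0 < ε) :
    ∀ᶠ n in atTop, |a n - c| < ε ∧ ∀ x ∈ Icc 0 q, |b n * f n x - d * g x| < ε := by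
  have h1 := aux_U hf hq0 hq (show 0 < ε / 2 / d by positivity)
  have h2 : ∀ᶠ n in atTop, |a n - c| < ε := by
    have := hf.a_lim.eventually (Metric.ball_mem_nhds c hε)
    simpa [Metric.mem_ball, Real.dist_eq] using this
  have h3 : ∀ᶠ n in atTop, |b n - d| < ε / 2 := by
    have := hf.b_lim.eventually (Metric.ball_mem_nhds d (half_pos hε))
    simpa [Metric.mem_ball, Real.dist_eq] using this
  filter_upwards [h1, h2, h3] with n h1 h2 h3
  refine ⟨h2, fun x hx => ?_⟩
  have h4 := (h1 x hx).1
  have h5 := hf.maps_to n x hx.1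
  have h6 : b n * f n x - d * g x = (b n - d) * f n x + d * (f n x - g x) := by ring
  rw [h6]
  have h7 : |(b n - d) * f n x| ≤ |b n - d| := by
    rw [abs_mul, abs_of_nonneg h5.1]
    exact mul_le_of_le_one_right (abs_nonneg _) h5.2.le
  have h8 : |d * (f n x - g x)| < ε / 2 := by
    rw [abs_mul, abs_of_pos hd, mul_comm]
    exact (lt_div_iff₀ hd).1 h4
  have := abs_add_le ((b n - d) * f n x) (d * (f n x - g x))
  linarith

lemma aux_gcont {g g' : ℝ → ℝ} (hg : CgA g g') : ContinuousOn g (Icc 0 1) :=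
  fun x hx => (hg.hasDeriv x hx).continuousWithinAt

lemma aux_gpos {c d : ℝ} {g g' : ℝ → ℝ} (hg : CgA g g') (hd : 0 < d) {ξ : ℝ}
    (hξ : ξ ∈ Ioo (0:ℝ) 1) (hz₁ : -c * ξ + d * g ξ = 0) {x : ℝ} (hx : ξ < x) (hx1 : x ≤ 1) :
    c * x < d * g x := by
  have hsm : StrictMonoOn (fun x => g x / x) (Icc ξ 1) := by
    refine strictMonoOn_of_deriv_pos (convex_Icc _ _) ?_ ?_
    · refine ContinuousOn.div ((aux_gcont hg).mono (Icc_subset_Icc_left hξ.1.le))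
        continuousOn_id ?_
      intro y hy
      have : 0 < y := lt_of_lt_of_le hξ.1 hy.1
      exact this.ne'
    · intro y hy
      rw [interior_Icc] at hy
      have hy0 : 0 < y := hξ.1.trans hy.1
      have h1 : HasDerivAt g (g' y) y :=
        (hg.hasDeriv y ⟨hy0.le, hy.2.le⟩).hasDerivAt (Icc_mem_nhds hy0 hy.2)
      have h2 : HasDerivAt (fun x => g x / x) ((g' y * y - g y * 1) / y ^ 2) y :=
        h1.div (hasDerivAt_id' y) hy0.ne'
      rw [h2.deriv]
      have h3 := hg.slope y hy0 hy.2.le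
      rw [div_lt_iff₀ hy0] at h3
      apply div_pos _ (by positivity)
      linarith
  have h1 := hsm ⟨le_rfl, hξ.2.le⟩ ⟨hx.le, hx1⟩ hx
  have hx0 : 0 < x := hξ.1.trans hx
  have h2 : g ξ / ξ = c / d := by
    rw [div_eq_div_iff hξ.1.ne' hd.ne']; linarith
  simp only [h2] at h1
  rw [div_lt_div_iff₀ hd hx0] at h1
  linarith

lemma aux_fmono {c d : ℝ} {g g' : ℝ → ℝ} (hg : CgA g g')
    {a b : ℕ → ℝ} {f f' : ℕ → ℝ → ℝ} (hf : Cfn c d g g' a b f f')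
    {q : ℝ} (hq0 : 1/2 < q) (hq : q < 1) :
    ∀ᶠ n in atTop, MonotoneOn (f n) (Icc 0 q) := by
  obtain ⟨x0, hx0, hmin⟩ := isCompact_Icc.exists_isMinOn (nonempty_Icc.2 hq0.le)
    (hg.derivCont.mono (Icc_subset_Icc (by norm_num) hq.le))
  have hx00 : 0 < x0 := by linarith [hx0.1]
  have hm : 0 < g' x0 := by
    have := hg.slope x0 hx00 (by linarith [hx0.2])
    exact lt_of_le_of_lt (div_nonneg (hg.maps_to x0 hx00.le).1 hx00.le) this
  filter_upwards [aux_U hf (by linarith) hq hm] with n hn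
  have hder : ∀ x, 0 < x → HasDerivAt (f n) (f' n x) x := fun x hx =>
    (hf.hasDeriv n x hx.le).hasDerivAt (Ici_mem_nhds hx)
  refine monotoneOn_of_deriv_nonneg (convex_Icc _ _) ?_ ?_ ?_
  · intro x hx
    exact ((hf.hasDeriv n x hx.1).continuousWithinAt).mono Icc_subset_Ici_self
  · intro x hx
    rw [interior_Icc] at hx
    exact (hder x hx.1).differentiableAt.differentiableWithinAt
  · intro x hx
    rw [interior_Icc] at hx
    rw [(hder x hx.1).deriv]
    by_cases h2 : x ≤ 1/2
    · exact (hf.f'_pos n x hx.1 h2).le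
    · push Not at h2
      have h3 : g' x0 ≤ g' x := hmin ⟨h2.le, hx.2.le⟩
      have h4 := (abs_lt.1 (hn x ⟨hx.1.le, hx.2.le⟩).2).1
      linarith

lemma aux_small {c d : ℝ} {g g' : ℝ → ℝ} (hg : CgA g g') (hc : 0 < c) (hd : 0 < d)
    {a b : ℕ → ℝ} {f f' : ℕ → ℝ → ℝ} (hf : Cfn c d g g' a b f f') :
    ∃ m : ℝ, 0 < m ∧ ∀ᶠ n in atTop, ∀ x ∈ Icc 0 m, b n * f n x ≤ a n / 2 * x := by
  have h0 : (0:ℝ) ∈ Icc (0:ℝ) 1 := by simp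
  have hk : 0 < c / (16 * d) := by positivity
  have h1 := (hg.derivCont 0 h0).tendsto
  rw [hg.g'_zero] at h1
  have h2 := h1.eventually (gt_mem_nhds hk)
  rw [eventually_nhdsWithin_iff, Metric.eventually_nhds_iff] at h2
  obtain ⟨r, hr, hr2⟩ := h2
  refine ⟨min (r/2) (1/2), lt_min (by linarith) (by norm_num), ?_⟩
  set m := min (r/2) (1/2) with hm
  have hmr : m ≤ r / 2 := min_le_left _ _
  have hm1 : m ≤ 1 / 2 := min_le_right _ _
  have hm0 : 0 < m := lt_min (by linarith) (by norm_num)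
  have ha : ∀ᶠ n in atTop, c / 2 < a n := hf.a_lim.eventually (lt_mem_nhds (by linarith))
  have hb : ∀ᶠ n in atTop, b n < 2 * d := hf.b_lim.eventually (gt_mem_nhds (by linarith))
  filter_upwards [aux_U hf hm0 (by linarith) hk, ha, hb] with n hn ha hb x hx
  have hfx : f n x ≤ c / (8 * d) * x := by
    have hcv := Convex.norm_image_sub_le_of_norm_hasDerivWithin_le (f := f n) (f' := f' n)
      (s := Icc 0 m) (x := 0) (y := x) (C := c / (8 * d))
      (fun y hy => (hf.hasDeriv n y hy.1).mono Icc_subset_Ici_self) (by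
        intro y hy
        have h3 := abs_lt.1 (hn y hy).2
        have h4 := hr2 (y := y) (by
          rw [Real.dist_eq, sub_zero, abs_of_nonneg hy.1]; linarith [hy.2])
          ⟨hy.1, by linarith [hy.2]⟩
        have h5 : 0 ≤ f' n y := by
          rcases hy.1.eq_or_lt with h | h
          · have hs : HasDerivWithinAt (f n) (f' n 0) (Ici 0) 0 := hf.hasDeriv n 0 le_rfl
            rw [← h]
            have hcf := hf.derivCont n 0 (by simp)
            have hcf' : Tendsto (f' n) (𝓝[>] 0) (nhds (f' n 0)) :=
              hcf.tendsto.mono_left (nhdsWithin_mono _ Ioi_subset_Ici_self)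
            refine ge_of_tendsto hcf' ?_
            have : Ioo (0:ℝ) (1/2) ∈ 𝓝[>] (0:ℝ) := Ioo_mem_nhdsGT (by norm_num)
            filter_upwards [this] with y hy
            exact (hf.f'_pos n y hy.1 hy.2.le).le
          · exact (hf.f'_pos n y h (by linarith [hy.2])).le
        rw [Real.norm_eq_abs, abs_of_nonneg h5]
        have h6 : c / (8 * d) = c / (16 * d) + c / (16 * d) := by field_simp; norm_num
        linarith) (convex_Icc _ _) ⟨le_rfl, hm0.le⟩ hx
    rw [hf.f_zero, sub_zero, sub_zero, Real.norm_eq_abs, Real.norm_eq_abs, abs_of_nonneg hx.1]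
      at hcv
    exact (le_abs_self _).trans hcv
  have hf0 := (hf.maps_to n x hx.1).1
  calc b n * f n x ≤ 2 * d * f n x := mul_le_mul_of_nonneg_right hb.le hf0
    _ ≤ 2 * d * (c / (8 * d) * x) := mul_le_mul_of_nonneg_left hfx (by linarith)
    _ = c / 2 / 2 * x := by field_simp; norm_num
    _ ≤ a n / 2 * x := by nlinarith [hx.1]

set_option maxHeartbeats 1000000 in
/-- for `d ∈ (c, d*)` and all sufficiently large `n`, the solutions
`y^{+,n}` tend to `0` as `t → ∞`. -/
theorem stmt_19 (c d dstar : ℝ) (g g' : ℝ → ℝ) (hg : CgA g g') (hc : 0 < c)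
    (a b : ℕ → ℝ) (f f' : ℕ → ℝ → ℝ) (hf : Cfn c d g g' a b f f')
    (z : ℝ → ℝ → ℝ) (hz : ∀ e : ℝ, c < e → IsZSol c e g (z e))
    (hds : c < dstar)
    (hD : {e : ℝ | c < e ∧ (∀ t : ℝ, 0 < t → z e t < 1) ∧ Tendsto (z e) atTop (nhds 0)}
        = Ioo c dstar)
    (hd : c < d ∧ d < dstar)
    (ξ₁ : ℝ) (hξ₁ : ξ₁ ∈ Ioo (0:ℝ) 1) (hz₁ : -c * ξ₁ + d * g ξ₁ = 0)
    (κp : ℝ) (hκp : κp ∈ Ioo 0 (1 - ξ₁))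
    (ξ1n : ℕ → ℝ) (hξ1n : Tendsto ξ1n atTop (nhds ξ₁))
    (hξ1nz : ∀ᶠ n in atTop, 0 < ξ1n n ∧ -a n * ξ1n n + b n * f n (ξ1n n) = 0)
    (ypn : ℕ → ℝ → ℝ)
    (hypn : ∀ᶠ n in atTop,
        IsSolR (a n) (b n) (f n) (ypn n) ∧ StrictMonoOn (ypn n) (Iic (0:ℝ)) ∧
        ypn n 0 = κp + ξ1n n ∧ Tendsto (ypn n) atBot (nhds (ξ1n n)) ∧
        ∀ t : ℝ, ypn n t ∈ Ioo (0:ℝ) (2 * d / c)) :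
    ∃ N : ℕ, ∀ n ≥ N, Tendsto (ypn n) atTop (nhds 0) := by
  obtain ⟨hcd, hdd⟩ := hd
  have hd0 : 0 < d := hc.trans hcd
  obtain ⟨-, hz1, hz0⟩ : d ∈ {e : ℝ | c < e ∧ (∀ t : ℝ, 0 < t → z e t < 1) ∧
      Tendsto (z e) atTop (nhds 0)} := by rw [hD]; exact ⟨hcd, hdd⟩
  -- constants
  obtain ⟨η, hη0, hη1, hη⟩ : ∃ η : ℝ, 0 < η ∧ η < 1 ∧
      ∀ x ∈ Icc (1 - η) 1, c + (d - c) / 2 < d * g x := by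
    have h1 := ((aux_gcont hg 1 (by simp)).tendsto).const_mul d
    rw [hg.g_one, mul_one] at h1
    have h2 := h1.eventually (lt_mem_nhds (show c + (d - c) / 2 < d by linarith))
    rw [eventually_nhdsWithin_iff, Metric.eventually_nhds_iff] at h2
    obtain ⟨r, hr, hr2⟩ := h2
    refine ⟨min (r/2) (1/2), lt_min (by linarith) (by norm_num),
      (min_le_right _ _).trans_lt (by norm_num), ?_⟩
    intro x hx
    have h3 := min_le_left (r/2) (1/2)
    have h4 := min_le_right (r/2) (1/2)
    refine hr2 ?_ ⟨by linarith [hx.1], hx.2⟩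
    rw [Real.dist_eq, abs_lt]
    constructor <;> linarith [hx.1, hx.2]
  set C := (Real.exp c - 1) / c + 1 with hCdef
  have hC0 : 0 < C := by
    have := Real.one_lt_exp_iff.2 hc
    have : 0 < (Real.exp c - 1) / c := div_pos (by linarith) hc
    linarith
  obtain ⟨v, hv0, hv1, hv2⟩ : ∃ v : ℝ, 0 < v ∧ v ≤ (d - c) / 8 ∧ C * v ≤ η / 2 := by
    refine ⟨min ((d - c) / 8) (η / 2 / C), lt_min (by linarith) (by positivity),
      min_le_left _ _, ?_⟩
    have := min_le_right ((d - c) / 8) (η / 2 / C)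
    rwa [le_div_iff₀ hC0, mul_comm] at this
  have hec : Real.exp (-c) < 1 := Real.exp_lt_one_iff.2 (by linarith)
  have hvp : 0 < v * ((1 - Real.exp (-c)) / c) := mul_pos hv0 (div_pos (by linarith) hc)
  obtain ⟨θ, hθ0, hθ1, hθ2⟩ : ∃ θ : ℝ, 0 < θ ∧ θ < 1 ∧
      1 < Real.exp (-c * θ) * (1 + v * ((1 - Real.exp (-c)) / c)) := by
    have h1 : Continuous (fun θ : ℝ =>
      Real.exp (-c * θ) * (1 + v * ((1 - Real.exp (-c)) / c))) := by fun_prop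
    have h2 := h1.tendsto 0
    simp only [mul_zero, Real.exp_zero, one_mul] at h2
    have h3 := (h2.eventually (lt_mem_nhds (show (1:ℝ) < 1 + v * ((1 - Real.exp (-c)) / c) by
      linarith))).filter_mono (nhdsWithin_le_nhds (s := Ioi (0:ℝ)))
    have h4 : Ioo (0:ℝ) 1 ∈ 𝓝[>] (0:ℝ) := Ioo_mem_nhdsGT (by norm_num)
    obtain ⟨θ, h5, h6⟩ := (h3.and h4).exists
    exact ⟨θ, h6.1, h6.2, h5⟩
  have hvθ : 0 < v * ((1 - Real.exp (-c * θ)) / c) :=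
    mul_pos hv0 (div_pos (by
      have := Real.exp_lt_one_iff.2 (show -c * θ < 0 by nlinarith)
      linarith) hc)
  obtain ⟨r, hr0, hr1, hr2, hr3, hr4, hr5, hr6⟩ : ∃ r : ℝ, 0 < r ∧ r < 1 / 2 ∧ r < η / 2 ∧
      r < (1 - ξ₁ - κp) / 2 ∧ Real.log (1 + r) / c < 1 ∧
      1 + r < 1 - r + v * ((1 - Real.exp (-c * θ)) / c) ∧
      1 + r < Real.exp (-c * θ) * (1 - r + v * ((1 - Real.exp (-c)) / c)) := by
    have hκ := hκp.2
    have e1 : ∀ᶠ r in 𝓝 (0:ℝ), r < 1 / 2 := gt_mem_nhds (by norm_num)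
    have e2 : ∀ᶠ r in 𝓝 (0:ℝ), r < η / 2 := gt_mem_nhds (by linarith)
    have e3 : ∀ᶠ r in 𝓝 (0:ℝ), r < (1 - ξ₁ - κp) / 2 := gt_mem_nhds (by linarith)
    have e4 : ∀ᶠ r in 𝓝 (0:ℝ), Real.log (1 + r) / c < 1 := by
      have : ContinuousAt (fun r : ℝ => Real.log (1 + r) / c) 0 :=
        ContinuousAt.div_const (ContinuousAt.log (by fun_prop) (by norm_num)) c
      exact this.eventually (gt_mem_nhds (by simp))
    have e5 : ∀ᶠ r in 𝓝 (0:ℝ), 1 + r < 1 - r + v * ((1 - Real.exp (-c * θ)) / c) := by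
      have h1 : Continuous (fun r : ℝ => 1 + r) := by fun_prop
      have h2 : Continuous (fun r : ℝ => 1 - r + v * ((1 - Real.exp (-c * θ)) / c)) := by fun_prop
      exact h1.continuousAt.eventually_lt h2.continuousAt (by simpa using hvθ)
    have e6 : ∀ᶠ r in 𝓝 (0:ℝ),
        1 + r < Real.exp (-c * θ) * (1 - r + v * ((1 - Real.exp (-c)) / c)) := by
      have h1 : Continuous (fun r : ℝ => 1 + r) := by fun_prop
      have h2 : Continuous (fun r : ℝ =>
        Real.exp (-c * θ) * (1 - r + v * ((1 - Real.exp (-c)) / c))) := by fun_prop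
      exact h1.continuousAt.eventually_lt h2.continuousAt (by simpa using hθ2)
    have hall := (e1.and (e2.and (e3.and (e4.and (e5.and e6))))).filter_mono
      (nhdsWithin_le_nhds (s := Ioi (0:ℝ)))
    obtain ⟨r, ⟨k1, k2, k3, k4, k5, k6⟩, k7⟩ := (hall.and self_mem_nhdsWithin).exists
    exact ⟨r, k7, k1, k2, k3, k4, k5, k6⟩
  set q := 1 - r with hq
  have hq0 : 1 / 2 < q := by linarith
  have hq1 : q < 1 := by linarith
  -- positivity of d g - c x on [ξ₁ + κp/2, q]
  obtain ⟨μ, hμ0, hμ⟩ : ∃ μ : ℝ, 0 < μ ∧ ∀ x ∈ Icc (ξ₁ + κp / 2) q, μ ≤ d * g x - c * x := by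
    have hne : (Icc (ξ₁ + κp / 2) q).Nonempty := nonempty_Icc.2 (by linarith [hκp.1])
    have hcont : ContinuousOn (fun x => d * g x - c * x) (Icc (ξ₁ + κp / 2) q) := by
      have := (aux_gcont hg).mono
        (Icc_subset_Icc (show 0 ≤ ξ₁ + κp / 2 by linarith [hξ₁.1, hκp.1]) hq1.le)
      fun_prop
    obtain ⟨x0, hx0, hmin⟩ := isCompact_Icc.exists_isMinOn hne hcont
    refine ⟨d * g x0 - c * x0, ?_, fun x hx => hmin hx⟩
    have := aux_gpos hg hd0 hξ₁ hz₁ (show ξ₁ < x0 by linarith [hx0.1, hκp.1])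
      (by linarith [hx0.2])
    linarith
  -- eventual facts
  have ev1 := aux_fmono hg hf hq0 hq1
  have ev2 := aux_U2 hd0 hf (by linarith) hq1 (half_pos hμ0)
  have ev3 := aux_U2 hd0 hf (by linarith) hq1 (show 0 < (d - c) / 8 by linarith)
  have ev4 : ∀ᶠ n in atTop, (Real.exp (a n) - 1) / a n < C := by
    have h1 : Tendsto (fun n => (Real.exp (a n) - 1) / a n) atTop (nhds ((Real.exp c - 1) / c)) :=
      (((Real.continuous_exp.tendsto c).comp hf.a_lim).sub_const 1).div hf.a_lim hc.ne'
    exact h1.eventually (gt_mem_nhds (by linarith))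
  have hexp : ∀ s : ℝ, Tendsto (fun n => Real.exp (-a n * s)) atTop (nhds (Real.exp (-c * s))) :=
    fun s => (Real.continuous_exp.tendsto _).comp ((hf.a_lim.neg).mul_const s)
  have hexp1 : Tendsto (fun n => Real.exp (-a n)) atTop (nhds (Real.exp (-c))) :=
    (Real.continuous_exp.tendsto _).comp hf.a_lim.neg
  have ev5 : ∀ᶠ n in atTop, 1 + r < q + v * ((1 - Real.exp (-a n * θ)) / a n) := by
    have h1 : Tendsto (fun n => q + v * ((1 - Real.exp (-a n * θ)) / a n)) atTop
        (nhds (q + v * ((1 - Real.exp (-c * θ)) / c))) :=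
      ((((hexp θ).const_sub 1).div hf.a_lim hc.ne').const_mul v).const_add q
    exact h1.eventually (lt_mem_nhds hr5)
  have ev6 : ∀ᶠ n in atTop,
      1 + r < Real.exp (-a n * θ) * (q + v * ((1 - Real.exp (-a n)) / a n)) := by
    have h1 : Tendsto (fun n => Real.exp (-a n * θ) * (q + v * ((1 - Real.exp (-a n)) / a n)))
        atTop (nhds (Real.exp (-c * θ) * (q + v * ((1 - Real.exp (-c)) / c)))) :=
      (hexp θ).mul ((((hexp1).const_sub 1).div hf.a_lim hc.ne').const_mul v |>.const_add q)
    exact h1.eventually (lt_mem_nhds hr6)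
  have hε : 0 < c / (2 * d) := by positivity
  have ev7 : ∀ᶠ n in atTop, ∀ x, 1 + r ≤ x → f n x ≤ c / (2 * d) := by
    obtain ⟨N, hN⟩ := hf.close r hr0 (by linarith) _ hε
    filter_upwards [eventually_ge_atTop N] with n hn x hx
    have h1 := hN n hn x (Or.inr hx)
    rw [hg.eq_zero x (by linarith), sub_zero] at h1
    linarith [abs_nonneg (f' n x - g' x), le_abs_self (f n x)]
  have ev8 : ∀ᶠ n in atTop, b n * (c / (2 * d)) / a n < 1 + r := by
    have h1 : Tendsto (fun n => b n * (c / (2 * d)) / a n) atTop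
        (nhds (d * (c / (2 * d)) / c)) := (hf.b_lim.mul_const _).div hf.a_lim hc.ne'
    have h2 : d * (c / (2 * d)) / c = 1 / 2 := by field_simp
    rw [h2] at h1
    exact h1.eventually (gt_mem_nhds (by linarith))
  have ev9 : ∀ᶠ n in atTop, ξ₁ - κp / 2 < ξ1n n ∧ ξ1n n < ξ₁ + (1 - ξ₁ - κp) / 2 :=
    (hξ1n.eventually (lt_mem_nhds (by linarith [hκp.1]))).and
      (hξ1n.eventually (gt_mem_nhds (by linarith [hκp.2])))
  have hT : ∀ᶠ n in atTop, ∃ T, ypn n T = 1 + r ∧ ∀ s ∈ Icc (T - 1) T, 1 + r ≤ ypn n s := by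
    filter_upwards [ev1, ev2, ev3, ev4, ev5, ev6, ev7, ev8, ev9, hypn]
      with n h1 h2 h3 h4 h5 h6 h7 h8 h9 hy
    obtain ⟨hs, hsm, hy0, -, hyb⟩ := hy
    have ha := hf.a_pos n
    have hb := hf.b_pos n
    have hF0 : ∀ x, 0 ≤ x → 0 ≤ f n x := fun x hx => (hf.maps_to n x hx).1
    have hFc : ContinuousOn (f n) (Ici 0) := fun x hx => (hf.hasDeriv n x hx).continuousWithinAt
    have hyp0 := (hyb 0).1
    obtain ⟨T, hTq, hTm⟩ := aux_hit hs ha hb hF0 hFc h1 (M := 2 * d / c)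
      (fun t => (hyb t).2.le) hsm.monotoneOn (by rw [hy0]; linarith [h9.2]) (by
        intro x hx
        have hx0 : 0 ≤ x := hyp0.le.trans hx.1
        have hx1 : x ≤ 1 := hx.2.trans hq1.le
        have k1 := hμ x ⟨by rw [hy0] at hx; linarith [hx.1, h9.1], hx.2⟩
        have k2 := abs_lt.1 (h2.2 x ⟨hx0, hx.2⟩)
        have k3 := abs_lt.1 h2.1
        have k4 : (a n - c) * x ≤ μ / 2 :=
          (mul_le_mul_of_nonneg_right k3.2.le hx0).trans
            (mul_le_of_le_one_right (half_pos hμ0).le hx1)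
        linarith [k2.1])
    have hrise := aux_rise hs ha hb hv0 h1 h4.le (by
      intro x hx
      have k0 : 1 - η ≤ x := by linarith [hx.1]
      have k1 := hη x ⟨k0, hx.2.trans hq1.le⟩
      have k2 := abs_lt.1 (h3.2 x ⟨by linarith, hx.2⟩)
      have k3 := abs_lt.1 h3.1
      have k4 : a n * q ≤ a n := mul_le_of_le_one_right ha.le hq1.le
      linarith [k2.1]) hTq hTm
    exact aux_plateau hs ha hb hF0 hv0 hθ0 hθ1 hr0 hrise h5.le h6.le h7 h8
  obtain ⟨T, hT⟩ := hT.choice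
  have hsol : ∀ᶠ n in atTop, IsSolR (a n) (b n) (f n) (ypn n) := hypn.mono (fun n h => h.1)
  have hconv := aux_toz hg hc hf (hz d hcd) hz1 (u := fun n s => ypn n (T n + s))
    (hsol.mono (fun n h => aux_shift h (T n))) hr0 hr4 (by
      filter_upwards [hT] with n hn
      refine ⟨by simpa using hn.1, fun s hs => hn.2 _ ⟨by linarith [hs.1], by linarith [hs.2]⟩⟩)
  set ρ := Real.log (1 + r) / c with hρ
  obtain ⟨m, hm0, hm⟩ := aux_small hg hc hd0 hf
  have hEm : 0 < Real.exp (-(c + 1)) * m := mul_pos (Real.exp_pos _) hm0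
  obtain ⟨S, hS0, hS⟩ : ∃ S : ℝ, 0 ≤ S ∧ z d S < Real.exp (-(c + 1)) * m :=
    ((eventually_ge_atTop 0).and (hz0.eventually (gt_mem_nhds hEm))).exists
  have hfin := (hconv S hS0).eventually (gt_mem_nhds hS)
  have ha1 : ∀ᶠ n in atTop, a n < c + 1 := hf.a_lim.eventually (gt_mem_nhds (by linarith))
  rw [← eventually_atTop]
  filter_upwards [hfin, hm, hsol, ha1] with n h1 h2 h3 h4
  have ha := hf.a_pos n
  have hb := hf.b_pos n
  set R := T n + (ρ + S) with hR
  refine aux_stab h3 ha hb hm0 (S := R - 1) ?_ h2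
  intro t ht
  have h5 := aux_lower h3 ha hb (show t ≤ R by linarith [ht.2]) (m := 0)
    (fun s _ => (hf.maps_to n _ (h3.2.1 _)).1)
  simp only [mul_zero, add_zero] at h5
  have h6 : Real.exp (-(c + 1)) ≤ Real.exp (-a n * (R - t)) :=
    Real.exp_le_exp.2 (by
      have h9 : a n * (R - t) ≤ a n := mul_le_of_le_one_right ha.le (by linarith [ht.1])
      linarith)
  have h7 := mul_le_mul_of_nonneg_right h6 (h3.2.1 t)
  have h8 : Real.exp (-(c + 1)) * ypn n t ≤ Real.exp (-(c + 1)) * m := by linarith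
  exact le_of_mul_le_mul_left h8 (Real.exp_pos _)
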